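/- Let n ≥ 2 be even, m an integer, and G ≅ H_{n,m} with generators x, y as above. Let t be odd, let 0 ≤ α₁ < ... < α_t < n be integers, and S = {x^{α₁}y, ..., x^{α_t}y}. Then |∏_t(S)| ≥ (t+1)/2. -/

import Mathlib

/-- `prodTuples t S` is the set of all `t`-fold products of distinct elements of `S`. -/
def prodTuples {G : Type*} [Group G] (t : ℕ) (S : Set G) : Set G :=
  {g : G | ∃ l : List G, l.Nodup ∧ l.length = t ∧ (∀ a ∈ l, a ∈ S) ∧ l.prod = g}

lemma aux_sums {ι A : Type*} [DecidableEq ι] [DecidableEq A] [AddCommGroup A] (f : ι → A) :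
    ∀ (k : ℕ) (T : Finset ι), T.card = 2 * k + 1 →
      (∀ b, (T.filter (fun i => f i = b)).card ≤ 2) →
      k + 1 ≤ ((T.powersetCard k).image (fun P => ∑ i ∈ P, f i)).card := by
  intro k
  induction k with
  | zero =>
    intro T _ _
    simp
  | succ k ih =>
    intro T hT hfib
    set Q := ((T.powersetCard (k+1)).image (fun P => ∑ i ∈ P, f i)) with hQ
    by_contra hcon
    have hQc : Q.card ≤ k + 1 := by omega
    have key : ∀ i ∈ T, ∀ j ∈ T, ∀ s ∈ Q, s - f i + f j ∈ Q := by
      intro i hi j hj s hs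
      by_cases hij : i = j
      · subst hij; simpa using hs
      set T' := (T.erase i).erase j with hT'
      have hjT : j ∈ T.erase i := Finset.mem_erase.2 ⟨Ne.symm hij, hj⟩
      have hT'c : T'.card = 2 * k + 1 := by
        rw [hT', Finset.card_erase_of_mem hjT, Finset.card_erase_of_mem hi]; omega
      have hsub : T' ⊆ T := (Finset.erase_subset _ _).trans (Finset.erase_subset _ _)
      have h1 := ih T' hT'c (fun b =>
        (Finset.card_le_card (Finset.filter_subset_filter _ hsub)).trans (hfib b))
      set Q' := ((T'.powersetCard k).image (fun P => ∑ i ∈ P, f i)) with hQ'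
      have gen : ∀ l ∈ T, l ∉ T' → ∀ s ∈ Q', f l + s ∈ Q := by
        intro l hl hlT s hs
        obtain ⟨P, hP, rfl⟩ := Finset.mem_image.1 hs
        obtain ⟨hP1, hP2⟩ := Finset.mem_powersetCard.1 hP
        have hlP : l ∉ P := fun h => hlT (hP1 h)
        refine Finset.mem_image.2 ⟨insert l P, Finset.mem_powersetCard.2 ⟨?_, ?_⟩, ?_⟩
        · exact Finset.insert_subset hl (hP1.trans hsub)
        · rw [Finset.card_insert_of_notMem hlP, hP2]
        · exact Finset.sum_insert hlP
      have hiT' : i ∉ T' := by simp [hT']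
      have hjT' : j ∉ T' := by simp [hT']
      have e1 : Q'.image (fun s => f i + s) = Q := by
        apply Finset.eq_of_subset_of_card_le
        · intro z hz
          obtain ⟨s, hs, rfl⟩ := Finset.mem_image.1 hz
          exact gen i hi hiT' s hs
        · rw [Finset.card_image_of_injective _ (add_right_injective (f i))]
          omega
      rw [← e1] at hs
      obtain ⟨s', hs', rfl⟩ := Finset.mem_image.1 hs
      have := gen j hj hjT' s' hs'
      convert this using 1
      abel
    have hne : Q.Nonempty := by
      rw [hQ, Finset.image_nonempty, Finset.powersetCard_nonempty]; omega
    obtain ⟨s, hs⟩ := hne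
    have hTne : T.Nonempty := Finset.card_pos.1 (by omega)
    obtain ⟨i, hi⟩ := hTne
    have h2 : T.card ≤ 2 * (T.image f).card :=
      Finset.card_le_mul_card_image T 2 (fun b _ => hfib b)
    have h3 : (T.image f).card ≤ Q.card := by
      rw [← Finset.card_image_of_injective (T.image f) (add_right_injective (s - f i))]
      apply Finset.card_le_card
      intro z hz
      obtain ⟨w, hw, rfl⟩ := Finset.mem_image.1 hz
      obtain ⟨j, hj, rfl⟩ := Finset.mem_image.1 hw
      exact key i hi j hj s hs
    omega

lemma aux_list {G ι : Type*} [DecidableEq ι] [Group G] (x y : G) (m : ℤ)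
    (hy : y ^ 2 = x ^ m) (hyx : y * x = x⁻¹ * y) (α : ι → ℕ) :
    ∀ (k : ℕ) (P C : Finset ι), P.card = k → C.card = k + 1 → Disjoint P C →
      ∃ l : List ι, l.Nodup ∧ l.length = 2 * k + 1 ∧ (∀ i ∈ l, i ∈ P ∪ C) ∧
        (l.map (fun i => x ^ α i * y)).prod
          = x ^ ((∑ i ∈ C, (α i : ℤ)) - ∑ i ∈ P, (α i : ℤ)) * y ^ (2 * k + 1) := by
  intro k
  induction k with
  | zero =>
    intro P C hP hC _
    obtain ⟨c, rfl⟩ := Finset.card_eq_one.1 hC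
    rw [Finset.card_eq_zero] at hP
    subst hP
    exact ⟨[c], by simp⟩
  | succ k ih =>
    intro P C hP hC hd
    obtain ⟨p, hp⟩ : P.Nonempty := Finset.card_pos.1 (by omega)
    obtain ⟨c, hc⟩ : C.Nonempty := Finset.card_pos.1 (by omega)
    obtain ⟨l, h1, h2, h3, h4⟩ := ih (P.erase p) (C.erase c)
      (by rw [Finset.card_erase_of_mem hp]; omega) (by rw [Finset.card_erase_of_mem hc]; omega)
      (hd.mono (Finset.erase_subset _ _) (Finset.erase_subset _ _))
    have hpC : p ∉ C := Finset.disjoint_left.1 hd hp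
    have hcP : c ∉ P := Finset.disjoint_right.1 hd hc
    have hcp : c ≠ p := fun h => hpC (h ▸ hc)
    refine ⟨c :: p :: l, ?_, by simp [h2]; ring, ?_, ?_⟩
    · have hpl : p ∉ l := fun h => by
        have := h3 p h; simp [hpC] at this
      have hcl : c ∉ l := fun h => by
        have := h3 c h; simp [hcP] at this
      simp [hcp, hpl, hcl, h1]
    · intro i hi
      simp only [List.mem_cons] at hi
      rcases hi with rfl | rfl | hi
      · simp [hc]
      · simp [hp]
      · have := h3 i hi
        simp only [Finset.mem_union, Finset.mem_erase] at this ⊢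
        tauto
    · have hconj : y * x ^ α p = (x ^ α p)⁻¹ * y := by
        have hs : SemiconjBy y x x⁻¹ := hyx
        have := hs.pow_right (α p)
        rw [inv_pow] at this
        exact this
      rw [← Finset.add_sum_erase C _ hc, ← Finset.add_sum_erase P _ hp]
      simp only [List.map_cons, List.prod_cons, h4]
      set e := (∑ i ∈ C.erase c, (α i : ℤ)) - ∑ i ∈ P.erase p, (α i : ℤ) with he
      have hexp : ((α c : ℤ) + ∑ i ∈ C.erase c, (α i : ℤ)) - (α p + ∑ i ∈ P.erase p, (α i : ℤ))
          = α c + (-α p) + e := by rw [he]; ring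
      rw [hexp, zpow_add, zpow_add, zpow_neg, zpow_natCast, zpow_natCast]
      have hy2 : y ^ 2 * x ^ e = x ^ e * y ^ 2 := by
        rw [hy, ← zpow_add, ← zpow_add, add_comm]
      calc x ^ α c * y * (x ^ α p * y * (x ^ e * y ^ (2 * k + 1)))
          = x ^ α c * (y * x ^ α p) * y * x ^ e * y ^ (2 * k + 1) := by group
        _ = x ^ α c * (x ^ α p)⁻¹ * (y ^ 2 * x ^ e) * y ^ (2 * k + 1) := by
            rw [hconj, pow_two]; simp only [mul_assoc]
        _ = _ := by
            rw [hy2, show 2 * (k + 1) + 1 = 2 + (2 * k + 1) by ring, pow_add y 2]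
            simp only [mul_assoc]

/-- For `n` even and `t` odd, a set `S` of `t` elements of the form `x^{α_i} y` in `H_{n,m}`
has at least `(t+1)/2` distinct `t`-fold products. -/
theorem card_prodTuples_ge_of_even_odd (n : ℕ) (m : ℤ) (hn : 2 ≤ n) (hne : Even n)
    {G : Type*} [Group G] [Fintype G]
    (hG : Fintype.card G = 2 * n) (x y : G)
    (hx : orderOf x = n) (hy : y ^ 2 = x ^ m) (hyx : y * x = x⁻¹ * y)
    (hgen : Subgroup.closure {x, y} = ⊤)
    (t : ℕ) (hto : Odd t) (α : Fin t → ℕ) (hmono : StrictMono α) (hα : ∀ i, α i < n) :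
    (t + 1) / 2 ≤ (prodTuples t (Set.range fun i => x ^ α i * y)).ncard := by
  classical
  obtain ⟨k, hk⟩ := hto
  haveI : NeZero n := ⟨by omega⟩
  have hginj : Function.Injective (fun i => x ^ α i * y) := by
    intro i j hij
    have h : x ^ α i = x ^ α j := mul_right_cancel hij
    apply hmono.injective
    exact pow_injOn_Iio_orderOf (by simpa [hx] using hα i) (by simpa [hx] using hα j) h
  let f : Fin t → ZMod n := fun i => ((2 * α i : ℕ) : ZMod n)
  have hfib : ∀ b, ((Finset.univ : Finset (Fin t)).filter (fun i => f i = b)).card ≤ 2 := by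
    intro b
    by_contra hcon
    obtain ⟨i, j, l, hi, hj, hl, hij, hil, hjl⟩ := Finset.two_lt_card_iff.1 (not_le.1 hcon)
    simp only [Finset.mem_filter, Finset.mem_univ, true_and] at hi hj hl
    have a1 := (ZMod.natCast_eq_natCast_iff' _ _ _).1 (hi.trans hj.symm)
    have a2 := (ZMod.natCast_eq_natCast_iff' _ _ _).1 (hi.trans hl.symm)
    have hij' : α i ≠ α j := fun h => hij (hmono.injective h)
    have hil' : α i ≠ α l := fun h => hil (hmono.injective h)
    have hjl' : α j ≠ α l := fun h => hjl (hmono.injective h)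
    have b1 := hα i
    have b2 := hα j
    have b3 := hα l
    have q : ∀ a, a < n → (2 * a) % n = if 2 * a < n then 2 * a else 2 * a - n := by
      intro a ha
      split_ifs with h
      · exact Nat.mod_eq_of_lt h
      · rw [Nat.mod_eq_sub_mod (by omega), Nat.mod_eq_of_lt (by omega)]
    rw [q _ b1, q _ b2] at a1
    rw [q _ b1, q _ b3] at a2
    split_ifs at a1 a2 <;> omega
  have main := aux_sums f k Finset.univ (by simp [hk]) hfib
  set Q := (((Finset.univ : Finset (Fin t)).powersetCard k).image (fun P => ∑ i ∈ P, f i)) with hQ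
  let a : ZMod n := ((∑ i, (α i : ℤ) : ℤ) : ZMod n)
  let ψ : ZMod n → G := fun v => x ^ (a - v).val * y ^ t
  have hψ : Function.Injective ψ := by
    intro u v huv
    have h : x ^ (a - u).val = x ^ (a - v).val := mul_right_cancel huv
    have := pow_injOn_Iio_orderOf (by simpa [hx] using ZMod.val_lt (a - u))
      (by simpa [hx] using ZMod.val_lt (a - v)) h
    exact sub_right_injective (ZMod.val_injective n this)
  have hsub : ((Q.image ψ : Finset G) : Set G) ⊆
      prodTuples t (Set.range fun i => x ^ α i * y) := by
    intro g hg
    obtain ⟨v, hv, rfl⟩ := Finset.mem_image.1 (Finset.mem_coe.1 hg)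
    obtain ⟨P, hP, rfl⟩ := Finset.mem_image.1 hv
    have hPc := (Finset.mem_powersetCard.1 hP).2
    obtain ⟨l, h1, h2, h3, h4⟩ := aux_list x y m hy hyx α k P Pᶜ hPc
      (by rw [Finset.card_compl, hPc, Fintype.card_fin]; omega) disjoint_compl_right
    refine ⟨l.map (fun i => x ^ α i * y), h1.map hginj, by simp [h2, hk], ?_, ?_⟩
    · intro z hz
      obtain ⟨i, _, rfl⟩ := List.mem_map.1 hz
      exact ⟨i, rfl⟩
    · rw [h4]
      change _ = x ^ (a - ∑ i ∈ P, f i).val * y ^ t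
      rw [← hk, ← zpow_natCast x (ZMod.val _)]
      congr 1
      rw [zpow_eq_zpow_iff_modEq, hx, ← ZMod.intCast_eq_intCast_iff]
      have hs := Finset.sum_add_sum_compl P (fun i => (α i : ℤ))
      have : (∑ i ∈ Pᶜ, (α i : ℤ)) - ∑ i ∈ P, (α i : ℤ)
          = (∑ i, (α i : ℤ)) - ∑ i ∈ P, 2 * (α i : ℤ) := by
        rw [← hs, ← Finset.mul_sum]; ring
      rw [this]
      simp [a, f]
  calc (t + 1) / 2 ≤ Q.card := by omega
    _ = (Q.image ψ).card := (Finset.card_image_of_injective _ hψ).symm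
    _ = ((Q.image ψ : Finset G) : Set G).ncard := (Set.ncard_coe_finset _).symm
    _ ≤ _ := Set.ncard_le_ncard hsub (Set.toFinite _)
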